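/- Let (G, v₀) and (G, v₁) be well-posed instances on the same finite connected weighted graph with the same terminal set T. If v₀(t) ≤ v₁(t) for all t ∈ T, then the lex-minimizers satisfy lex[v₀](x) ≤ lex[v₁](x) for all vertices x. Consequently, ‖lex[v₀] − lex[v₁]‖_∞ ≤ ‖v₀ − v₁‖_∞ (stability of the lex-minimizer). -/

import Mathlib

/-- Total length of a walk in a graph with edge lengths `ℓ`. -/
noncomputable def walkLen {V : Type*} (ℓ : Sym2 V → ℝ) {G : SimpleGraph V} {u v : V}
    (p : G.Walk u v) : ℝ :=
  (p.darts.map fun d => ℓ d.edge).sum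

/-- Shortest-path distance induced by edge lengths `ℓ`. -/
noncomputable def gdist {V : Type*} (G : SimpleGraph V) (ℓ : Sym2 V → ℝ) (u v : V) : ℝ :=
  sInf {x | ∃ p : G.Walk u v, walkLen ℓ p = x}

/-- Absolute gradient `|v x - v y| / ℓ(x,y)` of `v` on the unordered pair `e`. -/
noncomputable def absGrad {V : Type*} (ℓ : Sym2 V → ℝ) (v : V → ℝ) (e : Sym2 V) : ℝ :=
  Sym2.lift ⟨fun x y => |v x - v y|, fun x y => abs_sub_comm (v x) (v y)⟩ e / ℓ e

/-- The absolute edge gradients of `v`, sorted in decreasing order. -/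
noncomputable def gradList {V : Type*} [Fintype V] [DecidableEq V] (G : SimpleGraph V)
    [DecidableRel G.Adj] (ℓ : Sym2 V → ℝ) (v : V → ℝ) : List ℝ :=
  (G.edgeFinset.val.map (absGrad ℓ v)).sort (· ≥ ·)

theorem exists_countP_lt_of_lex {l₁ l₂ : List ℝ} (h : List.Lex (· < ·) l₁ l₂)
    (h₁ : l₁.Pairwise (· ≥ ·)) (h₂ : l₂.Pairwise (· ≥ ·)) :
    ∃ c : ℝ, l₁.countP (c ≤ ·) < l₂.countP (c ≤ ·) ∧
      ∀ d, c < d → l₁.countP (d ≤ ·) = l₂.countP (d ≤ ·) := by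
  have count_zero : ∀ {l : List ℝ} {a d : ℝ}, (a :: l).Pairwise (· ≥ ·) → a < d →
      (a :: l).countP (d ≤ ·) = 0 := by
    intro l a d hl had
    rw [List.countP_eq_zero]
    intro b hb
    rw [List.pairwise_cons] at hl
    rcases List.mem_cons.1 hb with rfl | hb
    · simpa using had
    · simpa using lt_of_le_of_lt (hl.1 b hb) had
  have count_pos : ∀ (l : List ℝ) (a : ℝ), 0 < (a :: l).countP (a ≤ ·) := fun l a =>
    List.countP_pos_iff.2 ⟨a, List.mem_cons_self, by simp⟩
  induction h with
  | @nil b l =>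
    exact ⟨b, count_pos l b, fun d hd => by rw [count_zero h₂ hd]; rfl⟩
  | @cons a l l' _ ih =>
    obtain ⟨c, hc, hd⟩ := ih (List.pairwise_cons.1 h₁).2 (List.pairwise_cons.1 h₂).2
    refine ⟨c, ?_, fun d hcd => ?_⟩
    · simpa only [List.countP_cons, add_lt_add_iff_right] using hc
    · simp only [List.countP_cons, hd d hcd]
  | @rel a l b l' hab =>
    refine ⟨b, ?_, fun d hd => ?_⟩
    · rw [count_zero h₁ hab]
      exact count_pos l' b
    · rw [count_zero h₁ (hab.trans hd), count_zero h₂ hd]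

theorem absGrad_mk {V : Type*} (ℓ : Sym2 V → ℝ) (v : V → ℝ) (x y : V) :
    absGrad ℓ v s(x, y) = |v x - v y| / ℓ s(x, y) := rfl

theorem absGrad_neg {V : Type*} (ℓ : Sym2 V → ℝ) (v : V → ℝ) : absGrad ℓ (-v) = absGrad ℓ v := by
  ext e
  induction e with | _ x y =>
  simp only [absGrad_mk, Pi.neg_apply]
  rw [← abs_neg]
  ring_nf

theorem absGrad_add_const {V : Type*} (ℓ : Sym2 V → ℝ) (v : V → ℝ) (c : ℝ) :
    absGrad ℓ (fun x => v x + c) = absGrad ℓ v := by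
  ext e
  induction e with | _ x y =>
  simp only [absGrad_mk, add_sub_add_right_eq_sub]

section LexMin

variable {V : Type*} [Fintype V] [DecidableEq V] (G : SimpleGraph V) [DecidableRel G.Adj]
  (ℓ : Sym2 V → ℝ)

theorem countP_gradList (v : V → ℝ) (c : ℝ) :
    (gradList G ℓ v).countP (c ≤ ·) = (G.edgeFinset.filter fun e => c ≤ absGrad ℓ v e).card := by
  have h := Multiset.coe_countP (fun x : ℝ => c ≤ x) (gradList G ℓ v)
  rw [← h, gradList, Multiset.sort_eq, Multiset.countP_map]
  rfl

/-- A function that is the strict lex-minimizer among all functions with the same values on `T`. -/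
def IsLexMin (T : Set V) (u : V → ℝ) : Prop :=
  ∀ w : V → ℝ, (∀ t ∈ T, w t = u t) → w ≠ u →
    List.Lex (· < ·) (gradList G ℓ u) (gradList G ℓ w)

variable {G ℓ} {T : Set V} {u u₀ u₁ : V → ℝ}

theorem IsLexMin.neg (h : IsLexMin G ℓ T u) : IsLexMin G ℓ T (-u) := by
  intro w hw hne
  have := h (-w) (fun t ht => by simp [hw t ht]) (fun e => hne (by rw [← e, neg_neg]))
  simpa only [gradList, absGrad_neg] using this

theorem IsLexMin.add_const (h : IsLexMin G ℓ T u) (c : ℝ) :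
    IsLexMin G ℓ T (fun x => u x + c) := by
  intro w hw hne
  have := h (fun x => w x + -c) (fun t ht => by simp [hw t ht])
    (fun e => hne (by ext x; rw [← congrFun e x]; ring))
  simpa only [gradList, absGrad_add_const] using this

/-- Off the terminals, every downward slope of a lex-minimizer is matched by an upward slope
that is at least as steep. -/
theorem IsLexMin.exists_slope_le (hℓ : ∀ e ∈ G.edgeSet, 0 < ℓ e) (h : IsLexMin G ℓ T u)
    {x y : V} (hx : x ∉ T) (hxy : G.Adj x y) :
    ∃ z, G.Adj x z ∧ (u x - u y) / ℓ s(x, y) ≤ (u z - u x) / ℓ s(x, z) := by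
  by_contra! hcon
  obtain ⟨m, hm, hmax⟩ := (G.neighborFinset x).exists_max_image
    (fun y => (u x - u y) / ℓ s(x, y)) ⟨y, by simpa using hxy⟩
  simp only [SimpleGraph.mem_neighborFinset] at hm hmax
  set a := (u x - u m) / ℓ s(x, m)
  have hup : ∀ z, G.Adj x z → u z - u x < a * ℓ s(x, z) := fun z hz =>
    (div_lt_iff₀ (hℓ _ hz)).1 ((hcon z hz).trans_le (hmax y hxy))
  have hdown : ∀ z, G.Adj x z → u x - u z ≤ a * ℓ s(x, z) := fun z hz =>
    (div_le_iff₀ (hℓ _ hz)).1 (hmax z hz)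
  obtain ⟨ε, hε, hε0⟩ : ∃ ε : ℝ, (∀ z, G.Adj x z → u z - u x + ε < a * ℓ s(x, z)) ∧ 0 < ε := by
    have hev : ∀ᶠ ε : ℝ in nhdsWithin 0 (Set.Ioi 0),
        ∀ z, G.Adj x z → u z - u x + ε < a * ℓ s(x, z) := by
      rw [Filter.eventually_all]
      intro z
      by_cases hz : G.Adj x z
      · have : ∀ᶠ ε : ℝ in nhdsWithin 0 (Set.Ioi 0), ε < a * ℓ s(x, z) - (u z - u x) :=
          nhdsWithin_le_nhds (eventually_lt_nhds (sub_pos.2 (hup z hz)))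
        filter_upwards [this] with ε hε _
        linarith
      · exact Filter.Eventually.of_forall fun _ hz' => absurd hz' hz
    exact (hev.and self_mem_nhdsWithin).exists
  set w := Function.update u x (u x - ε) with hw
  have hwx : w x = u x - ε := by simp [hw]
  have hwz : ∀ z, z ≠ x → w z = u z := fun z hz => by simp [hw, hz]
  have hlow : ∀ z, G.Adj x z → absGrad ℓ w s(x, z) < a := by
    intro z hz
    rw [absGrad_mk, div_lt_iff₀ (hℓ _ hz), hwx, hwz z hz.ne', abs_lt]
    constructor <;> linarith [hε z hz, hdown z hz]
  have hsub : ∀ d, a ≤ d → (G.edgeFinset.filter fun e => d ≤ absGrad ℓ w e) ⊆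
      G.edgeFinset.filter fun e => d ≤ absGrad ℓ u e := by
    intro d hd e
    simp only [Finset.mem_filter, SimpleGraph.mem_edgeFinset]
    refine fun ⟨he, hde⟩ => ⟨he, ?_⟩
    by_cases hxe : x ∈ e
    · obtain ⟨z, rfl⟩ := hxe
      exact absurd (hlow z he) (not_lt.2 (hd.trans hde))
    · induction e with | _ p q =>
      simp only [Sym2.mem_iff, not_or] at hxe
      rwa [absGrad_mk, hwz p (Ne.symm hxe.1), hwz q (Ne.symm hxe.2)] at hde
  obtain ⟨c, hc, heq⟩ := exists_countP_lt_of_lex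
    (h w (fun t ht => hwz t (fun e => hx (e ▸ ht)))
      (fun e => by have := congrFun e x; linarith))
    (Multiset.pairwise_sort _ _) (Multiset.pairwise_sort _ _)
  simp only [countP_gradList] at hc heq
  have hca : c < a := by
    by_contra! hac
    exact absurd (Finset.card_le_card (hsub c hac)) (not_le.2 hc)
  have hm' : s(x, m) ∈ G.edgeFinset.filter fun e => a ≤ absGrad ℓ u e := by
    simp only [Finset.mem_filter, SimpleGraph.mem_edgeFinset]
    exact ⟨hm, div_le_div_of_nonneg_right (le_abs_self _) (hℓ _ hm).le⟩
  rw [← Finset.eq_of_subset_of_card_le (hsub a le_rfl) (heq a hca).le] at hm'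
  exact absurd (hlow m hm) (not_lt.2 (Finset.mem_filter.1 hm').2)

/-- Comparison principle for lex-minimizers. -/
theorem IsLexMin.le_of_le (hG : G.Connected) (hℓ : ∀ e ∈ G.edgeSet, 0 < ℓ e) (hT : T.Nonempty)
    (h₀ : IsLexMin G ℓ T u₀) (h₁ : IsLexMin G ℓ T u₁) (hle : ∀ t ∈ T, u₀ t ≤ u₁ t) (x : V) :
    u₀ x ≤ u₁ x := by
  by_contra! hx
  obtain ⟨p, -, hp⟩ := Finset.univ.exists_max_image (fun y => u₀ y - u₁ y) ⟨x, Finset.mem_univ x⟩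
  obtain ⟨q, hq, hqmax⟩ := (Finset.univ.filter fun y => u₀ y - u₁ y = u₀ p - u₁ p).exists_max_image
    u₀ ⟨p, by simp⟩
  simp only [Finset.mem_filter, Finset.mem_univ, true_and, true_implies] at hp hq hqmax
  have hmem : ∀ y, u₀ y - u₁ y = u₀ p - u₁ p → y ∉ T := fun y hy hyT => by
    linarith [hp x, hle y hyT]
  have step : ∀ r y, u₀ r = u₀ q ∧ u₁ r = u₁ q → G.Adj r y → u₀ y = u₀ q ∧ u₁ y = u₁ q := by
    rintro r y ⟨hr₀, hr₁⟩ hry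
    have hrE : u₀ r - u₁ r = u₀ p - u₁ p := by rw [hr₀, hr₁, hq]
    have hrT := hmem r hrE
    have hdiff : ∀ z, u₀ z - u₀ r ≤ u₁ z - u₁ r := fun z => by linarith [hp z]
    have hsub : ∀ z, G.Adj r z → ∃ z', G.Adj r z' ∧
        (u₀ r - u₀ z) / ℓ s(r, z) ≤ (u₀ z' - u₀ r) / ℓ s(r, z') :=
      fun z hz => h₀.exists_slope_le hℓ hrT hz
    have hsuper : ∀ z, G.Adj r z → ∃ z', G.Adj r z' ∧
        (u₁ z - u₁ r) / ℓ s(r, z) ≤ (u₁ r - u₁ z') / ℓ s(r, z') := fun z hz => by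
      obtain ⟨z', hz', hs⟩ := h₁.neg.exists_slope_le hℓ hrT hz
      refine ⟨z', hz', ?_⟩
      simp only [Pi.neg_apply] at hs
      convert hs using 2 <;> ring
    obtain ⟨m, hm, hmax⟩ := (G.neighborFinset r).exists_max_image
      (fun z => (u₀ z - u₀ r) / ℓ s(r, z)) ⟨y, by simpa using hry⟩
    simp only [SimpleGraph.mem_neighborFinset] at hm hmax
    obtain ⟨k, hk, hmk⟩ := hsuper m hm
    obtain ⟨n, hn, hkn⟩ := hsub k hk
    have hk' : (u₁ r - u₁ k) / ℓ s(r, k) ≤ (u₀ r - u₀ k) / ℓ s(r, k) :=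
      div_le_div_of_nonneg_right (by linarith [hdiff k]) (hℓ _ hk).le
    have hmE : u₁ m - u₁ r ≤ u₀ m - u₀ r :=
      (div_le_div_iff_of_pos_right (hℓ _ hm)).1
        (hmk.trans (hk'.trans (hkn.trans (hmax n hn))))
    have hm₀ : u₀ m ≤ u₀ r := hr₀ ▸ hqmax m (by linarith [hdiff m])
    have hup : ∀ z, G.Adj r z → u₀ z - u₀ r ≤ 0 := fun z hz => by
      have := (div_le_iff₀ (hℓ _ hz)).1
        ((hmax z hz).trans (div_nonpos_of_nonpos_of_nonneg (sub_nonpos.2 hm₀) (hℓ _ hm).le))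
      linarith
    have hdown : ∀ z, G.Adj r z → u₀ r - u₀ z ≤ 0 := fun z hz => by
      obtain ⟨z', hz', hs⟩ := hsub z hz
      have := (div_le_iff₀ (hℓ _ hz)).1
        (hs.trans (div_nonpos_of_nonpos_of_nonneg (hup z' hz') (hℓ _ hz').le))
      linarith
    obtain ⟨z, hz, hs⟩ := hsuper y hry
    have hy₁ := (div_le_iff₀ (hℓ _ hry)).1 (hs.trans (div_nonpos_of_nonpos_of_nonneg
      (by linarith [hdiff z, hdown z hz] : u₁ r - u₁ z ≤ 0) (hℓ _ hz).le))
    constructor <;> linarith [hup y hry, hdown y hry, hdiff y]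
  obtain ⟨t, ht⟩ := hT
  have hreach : ∀ {a b : V}, G.Walk a b → u₀ a = u₀ q ∧ u₁ a = u₁ q → u₀ b = u₀ q ∧ u₁ b = u₁ q := by
    intro a b W
    induction W with
    | nil => exact id
    | cons hadj _ ih => exact fun ha => ih (step _ _ ha hadj)
  obtain ⟨W⟩ := hG.preconnected q t
  obtain ⟨ht₀, ht₁⟩ := hreach W ⟨rfl, rfl⟩
  exact hmem t (by rw [ht₀, ht₁, hq]) ht

end LexMin

/-- Monotonicity and `ℓ_∞`-stability of the lex-minimizer: if `v₀ ≤ v₁` on `T`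
then `lex[v₀] ≤ lex[v₁]` everywhere, and the lex-minimizers are at `ℓ_∞` distance
at most `‖v₀ − v₁‖_∞`. -/
theorem lex_min_monotone_and_stable {V : Type*} [Fintype V] [DecidableEq V]
    (G : SimpleGraph V) [DecidableRel G.Adj] (hG : G.Connected)
    (ℓ : Sym2 V → ℝ) (hℓ : ∀ e ∈ G.edgeSet, 0 < ℓ e)
    (T : Set V) (hT : T.Nonempty) (v₀ v₁ : V → ℝ)
    (u₀ u₁ : V → ℝ)
    (hext₀ : ∀ t ∈ T, u₀ t = v₀ t)
    (hlex₀ : ∀ w : V → ℝ, (∀ t ∈ T, w t = v₀ t) → w ≠ u₀ →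
      List.Lex (· < ·) (gradList G ℓ u₀) (gradList G ℓ w))
    (hext₁ : ∀ t ∈ T, u₁ t = v₁ t)
    (hlex₁ : ∀ w : V → ℝ, (∀ t ∈ T, w t = v₁ t) → w ≠ u₁ →
      List.Lex (· < ·) (gradList G ℓ u₁) (gradList G ℓ w))
    (hmono : ∀ t ∈ T, v₀ t ≤ v₁ t) :
    (∀ x : V, u₀ x ≤ u₁ x) ∧
      ∀ x : V, |u₀ x - u₁ x| ≤ sSup {r : ℝ | ∃ t ∈ T, r = |v₀ t - v₁ t|} := by
  have h₀ : IsLexMin G ℓ T u₀ := fun w hw => hlex₀ w fun t ht => (hw t ht).trans (hext₀ t ht)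
  have h₁ : IsLexMin G ℓ T u₁ := fun w hw => hlex₁ w fun t ht => (hw t ht).trans (hext₁ t ht)
  have hle : ∀ x, u₀ x ≤ u₁ x :=
    h₀.le_of_le hG hℓ hT h₁ fun t ht => by rw [hext₀ t ht, hext₁ t ht]; exact hmono t ht
  refine ⟨hle, fun x => ?_⟩
  set M := sSup {r : ℝ | ∃ t ∈ T, r = |v₀ t - v₁ t|}
  have hbdd : BddAbove {r : ℝ | ∃ t ∈ T, r = |v₀ t - v₁ t|} :=
    ((Set.finite_range fun t => |v₀ t - v₁ t|).subset
      (by rintro _ ⟨t, -, rfl⟩; exact ⟨t, rfl⟩)).bddAbove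
  have hupper := h₁.le_of_le hG hℓ hT (h₀.add_const M) (fun t ht => by
    have := (neg_le_abs _).trans (le_csSup hbdd ⟨t, ht, rfl⟩)
    rw [hext₀ t ht, hext₁ t ht]
    linarith) x
  rw [abs_le]
  constructor <;> linarith [hle x]
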